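/- arXiv:1909.10386 — 6 statements merged into one kernel-verified Lean document; each statement's English description precedes it below -/
import Mathlib

section
/- For every integer m ≥ 2, d(m, 4m + 1) ≤ 1260; that is, there exists an integral point set of 4m + 1 points in m-dimensional Euclidean space ℝ^m whose diameter is at most 1260. -/
open scoped InnerProductSpace in
/-- `m` vectors in `ℝ^m` of norm `4` whose pairwise inner products equal `7 / 2`. -/
theorem exists_equiangular_vectors (m : ℕ) (hm : 0 < m) :
    ∃ W : Fin m → EuclideanSpace ℝ (Fin m),
      ∀ i j, ⟪W i, W j⟫_ℝ = if i = j then 16 else 7 / 2 := by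
  have hm' : (0 : ℝ) < m := by exact_mod_cast hm
  obtain ⟨a, ha⟩ : ∃ a : ℝ, a ^ 2 = 25 / 2 := ⟨√(25 / 2), Real.sq_sqrt (by norm_num)⟩
  obtain ⟨s, hs⟩ : ∃ s : ℝ, s ^ 2 = 25 / 2 + 7 / 2 * m :=
    ⟨√(25 / 2 + 7 / 2 * m), Real.sq_sqrt (by positivity)⟩
  obtain ⟨b, hb⟩ : ∃ b : ℝ, m * b ^ 2 + 2 * a * b = 7 / 2 := by
    refine ⟨(s - a) / m, ?_⟩
    field_simp
    linear_combination 2 * hs - 2 * ha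
  refine ⟨fun i => WithLp.toLp 2 fun k => (if k = i then a else 0) + b, fun i j => ?_⟩
  have hsum : ⟪WithLp.toLp 2 fun k => (if k = i then a else 0) + b,
      (WithLp.toLp 2 fun k => (if k = j then a else 0) + b : EuclideanSpace ℝ (Fin m))⟫_ℝ
      = (if i = j then a ^ 2 else 0) + (m * b ^ 2 + 2 * a * b) := by
    simp only [PiLp.inner_apply, RCLike.inner_apply, conj_trivial, add_mul, mul_add,
      Finset.sum_add_distrib, ite_mul, mul_ite, zero_mul, mul_zero, Finset.sum_ite_eq',
      Finset.mem_univ, if_true, Finset.sum_const, Finset.card_univ, Fintype.card_fin,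
      nsmul_eq_mul]
    split_ifs <;> ring
  rw [hsum, hb, ha]
  split_ifs <;> norm_num

open scoped InnerProductSpace in
/-- Vectors of equal norm whose common inner product is nonnegative and less than the
squared norm are linearly independent. -/
theorem linearIndependent_of_equiangular {ι E : Type*} [Fintype ι] [DecidableEq ι]
    [NormedAddCommGroup E] [InnerProductSpace ℝ E] {W : ι → E} {x y : ℝ} (hy : 0 ≤ y)
    (hxy : y < x) (hW : ∀ i j, ⟪W i, W j⟫_ℝ = if i = j then x else y) :
    LinearIndependent ℝ W := by
  rw [Fintype.linearIndependent_iff]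
  intro c hc
  have hcoord : ∀ j, (x - y) * c j + y * ∑ i, c i = 0 := by
    intro j
    have h : ⟪∑ i, c i • W i, W j⟫_ℝ = 0 := by rw [hc, inner_zero_left]
    have hterm : ∀ i, ⟪c i • W i, W j⟫_ℝ = (if i = j then (x - y) * c i else 0) + y * c i := by
      intro i
      rw [real_inner_smul_left, hW]
      split_ifs <;> ring
    rw [sum_inner, Finset.sum_congr rfl fun i _ => hterm i, Finset.sum_add_distrib,
      Finset.sum_ite_eq', if_pos (Finset.mem_univ j), ← Finset.mul_sum] at h
    exact h
  have hpos : 0 < x - y := sub_pos.2 hxy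
  have hsum : ∑ i, c i = 0 := by
    have h : ∑ j, ((x - y) * c j + y * ∑ i, c i) = 0 := Finset.sum_eq_zero fun j _ => hcoord j
    rw [Finset.sum_add_distrib, ← Finset.mul_sum, Finset.sum_const, nsmul_eq_mul,
      ← mul_assoc, ← add_mul] at h
    exact (mul_eq_zero.1 h).resolve_left (by positivity)
  intro j
  have h := hcoord j
  rw [hsum, mul_zero, add_zero] at h
  exact (mul_eq_zero.1 h).resolve_left hpos.ne'

/-- The positions on a common line through the origin, in units of `4`. -/
def rayPosition : Fin 4 → ℤ := ![-33, 12, 44, 63]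

/-- The integer distances between points on two different lines. -/
def crossDistance : Fin 4 → Fin 4 → ℤ :=
  ![![165, 150, 242, 309], ![150, 60, 172, 246], ![242, 172, 220, 274], ![309, 246, 274, 315]]

theorem crossDistance_pos (k l : Fin 4) : 0 < crossDistance k l := by
  revert k l; decide

theorem crossDistance_le (k l : Fin 4) : crossDistance k l ≤ 1260 := by
  revert k l; decide

theorem crossDistance_sq (k l : Fin 4) :
    crossDistance k l ^ 2 =
      16 * (rayPosition k - rayPosition l) ^ 2 + 25 * (rayPosition k * rayPosition l) := by
  revert k l; decide

theorem rayPosition_ne_zero (k : Fin 4) : rayPosition k ≠ 0 := by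
  revert k; decide

theorem abs_rayPosition_le (k : Fin 4) : 4 * |rayPosition k| ≤ 1260 := by
  revert k; decide

theorem rayPosition_injective : Function.Injective rayPosition := by
  decide

theorem abs_rayPosition_sub_le (k l : Fin 4) : 4 * |rayPosition k - rayPosition l| ≤ 1260 := by
  revert k l; decide

/-- The origin together with four points on each of the lines spanned by the `W i`. -/
noncomputable def rayPoint {m : ℕ} (W : Fin m → EuclideanSpace ℝ (Fin m)) :
    Option (Fin m × Fin 4) → EuclideanSpace ℝ (Fin m)
  | none => 0
  | some (i, k) => (rayPosition k : ℝ) • W i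

open scoped InnerProductSpace in
theorem dist_rayPoint {m : ℕ} {W : Fin m → EuclideanSpace ℝ (Fin m)}
    (hW : ∀ i j, ⟪W i, W j⟫_ℝ = if i = j then 16 else 7 / 2) (p q : Option (Fin m × Fin 4)) :
    ∃ z : ℤ, (p ≠ q → 0 < z) ∧ z ≤ 1260 ∧ dist (rayPoint W p) (rayPoint W q) = z := by
  have hnorm : ∀ i, ‖W i‖ = 4 := by
    intro i
    have h := hW i i
    rw [if_pos rfl, real_inner_self_eq_norm_sq] at h
    nlinarith [norm_nonneg (W i)]
  have horigin : ∀ i k, ‖(rayPosition k : ℝ) • W i‖ = ((4 * |rayPosition k| : ℤ) : ℝ) := by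
    intro i k
    rw [norm_smul, hnorm, Real.norm_eq_abs]
    push_cast
    ring
  rcases p with _ | ⟨i, k⟩ <;> rcases q with _ | ⟨j, l⟩
  · exact ⟨0, by simp, by norm_num, by simp⟩
  · refine ⟨4 * |rayPosition l|, fun _ => ?_, abs_rayPosition_le l, ?_⟩
    · have := abs_pos.2 (rayPosition_ne_zero l)
      positivity
    · rw [rayPoint, rayPoint, dist_zero_left, horigin]
  · refine ⟨4 * |rayPosition k|, fun _ => ?_, abs_rayPosition_le k, ?_⟩
    · have := abs_pos.2 (rayPosition_ne_zero k)
      positivity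
    · rw [rayPoint, rayPoint, dist_zero_right, horigin]
  · by_cases hij : i = j
    · subst hij
      refine ⟨4 * |rayPosition k - rayPosition l|, fun h => ?_, abs_rayPosition_sub_le k l, ?_⟩
      · have hkl : rayPosition k ≠ rayPosition l := fun e => h (by rw [rayPosition_injective e])
        have := abs_pos.2 (sub_ne_zero.2 hkl)
        positivity
      · rw [rayPoint, rayPoint, dist_eq_norm, ← sub_smul, norm_smul, hnorm, Real.norm_eq_abs]
        push_cast
        ring
    · refine ⟨crossDistance k l, fun _ => crossDistance_pos k l, crossDistance_le k l, ?_⟩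
      have hpos : (0 : ℝ) < crossDistance k l := by exact_mod_cast crossDistance_pos k l
      have hsq : (crossDistance k l : ℝ) ^ 2 = 16 * (rayPosition k - rayPosition l) ^ 2 +
          25 * (rayPosition k * rayPosition l) := by exact_mod_cast crossDistance_sq k l
      rw [rayPoint, rayPoint, dist_eq_norm, ← sq_eq_sq₀ (norm_nonneg _) hpos.le,
        norm_sub_sq_real, norm_smul, norm_smul, hnorm, hnorm, real_inner_smul_left,
        real_inner_smul_right, hW, if_neg hij, hsq, mul_pow, mul_pow, Real.norm_eq_abs,
        Real.norm_eq_abs, sq_abs, sq_abs]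
      ring

theorem affineSpan_range_rayPoint {m : ℕ} {W : Fin m → EuclideanSpace ℝ (Fin m)}
    (hW : Submodule.span ℝ (Set.range W) = ⊤) :
    affineSpan ℝ (Set.range (rayPoint W)) = ⊤ := by
  have hzero : (0 : EuclideanSpace ℝ (Fin m)) ∈ Set.range (rayPoint W) := ⟨none, rfl⟩
  have hspan : Submodule.span ℝ (Set.range (rayPoint W)) = ⊤ := by
    rw [eq_top_iff, ← hW, Submodule.span_le]
    rintro _ ⟨i, rfl⟩
    have h : (rayPosition 0 : ℝ) ≠ 0 := by exact_mod_cast rayPosition_ne_zero 0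
    rw [SetLike.mem_coe, ← Submodule.smul_mem_iff _ h]
    exact Submodule.subset_span ⟨some (i, 0), rfl⟩
  rw [← AffineSubspace.coe_eq_univ_iff, ← Set.insert_eq_of_mem hzero,
    affineSpan_insert_zero, hspan, Submodule.top_coe]

/-- For every integer `m ≥ 2`, there exists an integral point set of `4 * m + 1` points in
`ℝ^m` (pairwise integral distances, not contained in any affine hyperplane) whose
diameter is at most `1260`; that is, `d(m, 4 * m + 1) ≤ 1260`. -/
theorem d_bound_stmt_4 :
    ∀ m : ℕ, 2 ≤ m →
      ∃ S : Finset (EuclideanSpace ℝ (Fin m)),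
        S.card = 4 * m + 1 ∧
        affineSpan ℝ (S : Set (EuclideanSpace ℝ (Fin m))) = ⊤ ∧
        (∀ p ∈ S, ∀ q ∈ S, ∃ z : ℤ, dist p q = (z : ℝ)) ∧
        Metric.diam (S : Set (EuclideanSpace ℝ (Fin m))) ≤ 1260 := by
  intro m hm
  obtain ⟨W, hW⟩ := exists_equiangular_vectors m (by lia)
  have hspan : Submodule.span ℝ (Set.range W) = ⊤ :=
    (linearIndependent_of_equiangular (by norm_num) (by norm_num)
      hW).span_eq_top_of_card_eq_finrank' (by simp)
  have hinj : Function.Injective (rayPoint W) := by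
    intro p q hpq
    by_contra hne
    obtain ⟨z, hz, -, hdist⟩ := dist_rayPoint hW p q
    rw [hpq, dist_self] at hdist
    exact (hz hne).ne (by exact_mod_cast hdist)
  refine ⟨Finset.univ.map ⟨rayPoint W, hinj⟩, ?_, ?_, ?_, ?_⟩
  · simp [mul_comm]
  · simpa using affineSpan_range_rayPoint hspan
  · simp only [Finset.mem_map, Finset.mem_univ, true_and, Function.Embedding.coeFn_mk]
    rintro _ ⟨p, rfl⟩ _ ⟨q, rfl⟩
    obtain ⟨z, -, -, hz⟩ := dist_rayPoint hW p q
    exact ⟨z, hz⟩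
  · refine Metric.diam_le_of_forall_dist_le (by norm_num) ?_
    simp only [Finset.mem_coe, Finset.mem_map, Finset.mem_univ, true_and,
      Function.Embedding.coeFn_mk]
    rintro _ ⟨p, rfl⟩ _ ⟨q, rfl⟩
    obtain ⟨z, -, hle, hz⟩ := dist_rayPoint hW p q
    rw [hz]
    exact_mod_cast hle
end

section
/- For every integer m ≥ 2, d(m, 2m + 4) ≤ 21; that is, there exists an integral point set of 2m + 4 points in m-dimensional Euclidean space ℝ^m whose diameter is at most 21. -/
namespace IntegralPointSet

open Finset

/-- The point of `ℝ^(k+1)` with first coordinate `t` and remaining coordinates `w`. -/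
def point {k : ℕ} (t : ℝ) (w : Fin k → ℝ) : EuclideanSpace ℝ (Fin (k + 1)) :=
  WithLp.toLp 2 (Fin.cons t w)

theorem dist_point_sq {k : ℕ} (s t : ℝ) (u w : Fin k → ℝ) :
    dist (point s u) (point t w) ^ 2 = (s - t) ^ 2 + ∑ l, (u l - w l) ^ 2 := by
  rw [EuclideanSpace.dist_eq, Real.sq_sqrt (by positivity), Fin.sum_univ_succ]
  simp [point, Real.dist_eq, sq_abs]

theorem dist_point_eq {k : ℕ} {s t : ℝ} {u w : Fin k → ℝ} {z : ℤ} (hz : 0 ≤ z)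
    (h : (s - t) ^ 2 + ∑ l, (u l - w l) ^ 2 = (z : ℝ) ^ 2) :
    dist (point s u) (point t w) = z := by
  have hz' : (0 : ℝ) ≤ z := by exact_mod_cast hz
  rw [← sq_eq_sq₀ dist_nonneg hz', dist_point_sq, h]

/-- The `i`-th vertex of a regular simplex in `ℝ^k`, with coordinates `α` except for an extra
`β` in the `i`-th place. -/
def vertex {k : ℕ} (α β : ℝ) (i : Fin k) : Fin k → ℝ :=
  fun l => α + if l = i then β else 0

theorem sum_vertex_sq {k : ℕ} (α β : ℝ) (i : Fin k) :
    ∑ l, vertex α β i l ^ 2 = k * α ^ 2 + 2 * α * β + β ^ 2 := by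
  have h : ∀ l, vertex α β i l ^ 2 = α ^ 2 + if l = i then 2 * α * β + β ^ 2 else 0 := by
    intro l
    unfold vertex
    split_ifs <;> ring
  simp only [h, sum_add_distrib, sum_ite_eq', mem_univ, if_true, sum_const, card_univ,
    Fintype.card_fin, nsmul_eq_mul]
  ring

theorem sum_vertex_sub_vertex_sq {k : ℕ} (α β : ℝ) {i j : Fin k} (hij : i ≠ j) :
    ∑ l, (vertex α β i l - vertex α β j l) ^ 2 = 2 * β ^ 2 := by
  have h : ∀ l, (vertex α β i l - vertex α β j l) ^ 2 =
      (if l = i then β ^ 2 else 0) + if l = j then β ^ 2 else 0 := by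
    intro l
    unfold vertex
    by_cases hi : l = i
    · simp [hi, hij]
    · by_cases hj : l = j <;> simp [hi, hj, hij.symm]
  simp only [h, sum_add_distrib, sum_ite_eq', mem_univ, if_true]
  ring

/-- There are regular simplex vertices of norm `√315 / 2` with edge length `6`. -/
theorem exists_vertex_parameters (k : ℕ) (hk : 1 ≤ k) :
    ∃ α β : ℝ, 0 ≤ α ∧ 0 < β ∧ β ^ 2 = 18 ∧ k * α ^ 2 + 2 * α * β + β ^ 2 = 315 / 4 := by
  have hk' : (0 : ℝ) < k := by exact_mod_cast hk
  have hβ : √(18 : ℝ) ^ 2 = 18 := Real.sq_sqrt (by norm_num)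
  have hγ : √(18 + k * (243 / 4) : ℝ) ^ 2 = 18 + k * (243 / 4) := Real.sq_sqrt (by positivity)
  refine ⟨(√(18 + k * (243 / 4)) - √18) / k, √18, ?_, by positivity, hβ, ?_⟩
  · have : √(18 : ℝ) ≤ √(18 + k * (243 / 4)) := Real.sqrt_le_sqrt (by linarith)
    exact div_nonneg (by linarith) hk'.le
  · generalize √(18 + k * (243 / 4) : ℝ) = γ at hγ
    field_simp
    linear_combination 4 * hγ + (4 * (k : ℝ) - 4) * hβ

/-- Positions of the collinear points. -/
def axisPosition : Fin 6 → ℤ := ![0, 5, 8, 13, 16, 21]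

/-- Positions, along the axis, of the two parallel simplices. -/
noncomputable def simplexPosition : Fin 2 → ℝ := ![13 / 2, 29 / 2]

/-- Six collinear points together with two translates of a simplex. -/
noncomputable def config {k : ℕ} (α β : ℝ) :
    Fin 6 ⊕ Fin 2 × Fin k → EuclideanSpace ℝ (Fin (k + 1))
  | .inl c => point (axisPosition c) 0
  | .inr (e, i) => point (simplexPosition e) (vertex α β i)

section Distances

variable {k : ℕ} {α β : ℝ}

theorem dist_axis_axis {c d : Fin 6} (hcd : c ≠ d) :
    ∃ z : ℤ, 0 < z ∧ z ≤ 21 ∧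
      dist (point (axisPosition c) (0 : Fin k → ℝ)) (point (axisPosition d) 0) = z := by
  have hz : 0 < |axisPosition c - axisPosition d| ∧ |axisPosition c - axisPosition d| ≤ 21 := by
    revert c d
    decide
  refine ⟨|axisPosition c - axisPosition d|, hz.1, hz.2, dist_point_eq hz.1.le ?_⟩
  simp [sq_abs]

theorem dist_axis_simplex (hα : k * α ^ 2 + 2 * α * β + β ^ 2 = 315 / 4)
    (c : Fin 6) (e : Fin 2) (i : Fin k) :
    ∃ z : ℤ, 0 < z ∧ z ≤ 21 ∧
      dist (point (axisPosition c) 0) (point (simplexPosition e) (vertex α β i)) = z := by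
  have key : ∃ z : ℤ, 0 < z ∧ z ≤ 21 ∧
      ((axisPosition c : ℝ) - simplexPosition e) ^ 2 + 315 / 4 = (z : ℝ) ^ 2 := by
    refine ⟨(![![11, 17], ![9, 13], ![9, 11], ![11, 9], ![13, 9], ![17, 11]] :
      Fin 6 → Fin 2 → ℤ) c e, ?_⟩
    fin_cases c <;> fin_cases e <;> norm_num [axisPosition, simplexPosition]
  obtain ⟨z, hz, hz', h⟩ := key
  refine ⟨z, hz, hz', dist_point_eq hz.le ?_⟩
  rw [← h, ← hα, ← sum_vertex_sq α β i]
  simp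

theorem dist_simplex_simplex (hβ : β ^ 2 = 18) {e f : Fin 2} {i j : Fin k}
    (h : (e, i) ≠ (f, j)) :
    ∃ z : ℤ, 0 < z ∧ z ≤ 21 ∧
      dist (point (simplexPosition e) (vertex α β i))
        (point (simplexPosition f) (vertex α β j)) = z := by
  have hpos : e ≠ f → (simplexPosition e - simplexPosition f) ^ 2 = 64 := by
    fin_cases e <;> fin_cases f <;> norm_num [simplexPosition]
  by_cases hij : i = j
  · subst hij
    have hef : e ≠ f := fun hef => h (by rw [hef])
    refine ⟨8, by norm_num, by norm_num, dist_point_eq (by norm_num) ?_⟩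
    rw [hpos hef]
    norm_num
  · by_cases hef : e = f
    · subst hef
      refine ⟨6, by norm_num, by norm_num, dist_point_eq (by norm_num) ?_⟩
      rw [sum_vertex_sub_vertex_sq α β hij, hβ]
      norm_num
    · refine ⟨10, by norm_num, by norm_num, dist_point_eq (by norm_num) ?_⟩
      rw [sum_vertex_sub_vertex_sq α β hij, hβ, hpos hef]
      norm_num

theorem dist_config (hβ : β ^ 2 = 18) (hα : k * α ^ 2 + 2 * α * β + β ^ 2 = 315 / 4)
    {a b : Fin 6 ⊕ Fin 2 × Fin k} (hab : a ≠ b) :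
    ∃ z : ℤ, 0 < z ∧ z ≤ 21 ∧ dist (config α β a) (config α β b) = z := by
  rcases a with c | ⟨e, i⟩ <;> rcases b with d | ⟨f, j⟩
  · exact dist_axis_axis fun h => hab (by rw [h])
  · exact dist_axis_simplex hα c f j
  · rw [dist_comm]
    exact dist_axis_simplex hα d e i
  · exact dist_simplex_simplex hβ fun h => hab (by rw [h])

end Distances

theorem inner_point {k : ℕ} (t : ℝ) (w : Fin k → ℝ) (x : EuclideanSpace ℝ (Fin (k + 1))) :
    inner ℝ (point t w) x = t * x 0 + ∑ l, w l * x l.succ := by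
  rw [PiLp.inner_apply, Fin.sum_univ_succ]
  simp [point, mul_comm]

theorem eq_zero_of_inner_config_eq_zero {k : ℕ} {α β : ℝ} (hα : 0 ≤ α) (hβ : 0 < β)
    {x : EuclideanSpace ℝ (Fin (k + 1))} (hx : ∀ a, inner ℝ (config α β a) x = 0) : x = 0 := by
  have h0 : x 0 = 0 := by
    have h := hx (.inl 1)
    simpa [config, inner_point, axisPosition] using h
  have hi : ∀ i : Fin k, α * ∑ l, x (Fin.succ l) + β * x i.succ = 0 := by
    intro i
    have h := hx (.inr (0, i))
    simpa [config, inner_point, h0, vertex, add_mul, sum_add_distrib, mul_sum] using h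
  have hsum : (k * α + β) * ∑ l : Fin k, x l.succ = 0 := by
    have h : ∑ i : Fin k, (α * ∑ l, x (Fin.succ l) + β * x i.succ) = 0 :=
      sum_eq_zero fun i _ => hi i
    rw [sum_add_distrib, sum_const, ← mul_sum, card_univ, Fintype.card_fin, nsmul_eq_mul] at h
    linarith
  have hpos : (k * α + β : ℝ) ≠ 0 := by positivity
  have hzero := (mul_eq_zero.mp hsum).resolve_left hpos
  ext l
  refine Fin.cases h0 (fun i => ?_) l
  have h := hi i
  rw [hzero, mul_zero, zero_add] at h
  exact (mul_eq_zero.mp h).resolve_left hβ.ne'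

theorem affineSpan_range_config {k : ℕ} {α β : ℝ} (hα : 0 ≤ α) (hβ : 0 < β) :
    affineSpan ℝ (Set.range (config (k := k) α β)) = ⊤ := by
  have hzero : config (k := k) α β (.inl 0) = 0 := by
    ext l
    refine Fin.cases ?_ (fun i => ?_) l <;> simp [config, point, axisPosition]
  have hmem : ∀ a, config (k := k) α β a ∈ affineSpan ℝ (Set.range (config (k := k) α β)) :=
    fun a => subset_affineSpan ℝ _ ⟨a, rfl⟩
  rw [← AffineSubspace.direction_eq_top_iff_of_nonempty ⟨_, hmem (.inl 0)⟩,
    ← Submodule.orthogonal_eq_bot_iff, eq_bot_iff]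
  intro x hx
  refine eq_zero_of_inner_config_eq_zero hα hβ fun a => hx _ ?_
  simpa [hzero] using AffineSubspace.vsub_mem_direction (hmem a) (hmem (.inl 0))

end IntegralPointSet

open IntegralPointSet in
/-- For every integer `m ≥ 2`, there exists an integral point set of `2 * m + 4` points in
`ℝ^m` (pairwise integral distances, not contained in any affine hyperplane) whose
diameter is at most `21`; that is, `d(m, 2 * m + 4) ≤ 21`. -/
theorem d_bound_stmt_6 :
    ∀ m : ℕ, 2 ≤ m →
      ∃ S : Finset (EuclideanSpace ℝ (Fin m)),
        S.card = 2 * m + 4 ∧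
        affineSpan ℝ (S : Set (EuclideanSpace ℝ (Fin m))) = ⊤ ∧
        (∀ p ∈ S, ∀ q ∈ S, ∃ z : ℤ, dist p q = (z : ℝ)) ∧
        Metric.diam (S : Set (EuclideanSpace ℝ (Fin m))) ≤ 21 := by
  intro m hm
  obtain ⟨k, rfl⟩ : ∃ k, m = k + 1 := ⟨m - 1, by omega⟩
  obtain ⟨α, β, hα, hβ, hβ', hαβ⟩ := exists_vertex_parameters k (by omega)
  have hdist : ∀ a b, ∃ z : ℤ, z ≤ 21 ∧ dist (config (k := k) α β a) (config α β b) = z := by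
    intro a b
    rcases eq_or_ne a b with rfl | hab
    · exact ⟨0, by norm_num, by simp⟩
    · obtain ⟨z, -, hz⟩ := dist_config hβ' hαβ hab
      exact ⟨z, hz⟩
  have hinj : Function.Injective (config (k := k) α β) := by
    intro a b h
    by_contra hab
    obtain ⟨z, hz, -, hd⟩ := dist_config hβ' hαβ hab
    rw [h, dist_self] at hd
    exact hz.ne (by exact_mod_cast hd)
  refine ⟨Finset.univ.map ⟨config α β, hinj⟩, ?_, ?_, ?_, ?_⟩
  · simp only [Finset.card_map, Finset.card_univ, Fintype.card_sum, Fintype.card_prod,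
      Fintype.card_fin]
    ring
  · simpa using affineSpan_range_config hα hβ
  · intro p hp q hq
    obtain ⟨a, -, rfl⟩ := Finset.mem_map.mp hp
    obtain ⟨b, -, rfl⟩ := Finset.mem_map.mp hq
    obtain ⟨z, -, hz⟩ := hdist a b
    exact ⟨z, hz⟩
  · refine Metric.diam_le_of_forall_dist_le (by norm_num) fun p hp q hq => ?_
    obtain ⟨a, -, rfl⟩ := Finset.mem_map.mp (Finset.mem_coe.mp hp)
    obtain ⟨b, -, rfl⟩ := Finset.mem_map.mp (Finset.mem_coe.mp hq)
    obtain ⟨z, hz, hd⟩ := hdist a b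
    refine hd.trans_le ?_
    exact_mod_cast hz
end

section
/- For every integer m ≥ 2, d(m, 2m + 6) ≤ 158; that is, there exists an integral point set of 2m + 6 points in m-dimensional Euclidean space ℝ^m whose diameter is at most 158. -/
namespace IntegralPointSet

/-- Heights of the eight points on the special line. -/
def axisHeight : Fin 8 → ℤ := ![-78, -62, -55, -10, 10, 55, 62, 78]

/-- Heights of the two points on every other line. -/
def pairHeight : Fin 2 → ℤ := ![-44, 44]

/-- Distances between the points of the special line and the points of another line. -/
def crossDist : Fin 8 → Fin 2 → ℤ :=
  ![![106, 158], ![102, 146], ![101, 141], ![106, 114],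
    ![114, 106], ![141, 101], ![146, 102], ![158, 106]]

theorem crossDist_sq :
    ∀ i s, (axisHeight i - pairHeight s) ^ 2 + 10080 = crossDist i s ^ 2 := by decide

theorem crossDist_mem : ∀ i s, 0 < crossDist i s ∧ crossDist i s ≤ 158 := by decide

theorem axisHeight_sub_mem :
    ∀ i j, |axisHeight i - axisHeight j| ≤ 158 ∧ (|axisHeight i - axisHeight j| = 0 → i = j) := by
  decide

theorem pairHeight_sub_mem :
    ∀ s t, |pairHeight s - pairHeight t| ≤ 158 ∧ (|pairHeight s - pairHeight t| = 0 → s = t) := by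
  decide

theorem exists_pairHeight_sub_sq :
    ∀ s t, ∃ z : ℤ, 0 < z ∧ z ≤ 158 ∧ (pairHeight s - pairHeight t) ^ 2 + 66 ^ 2 = z ^ 2 := by
  intro s t
  fin_cases s <;> fin_cases t
  · exact ⟨66, by decide⟩
  · exact ⟨110, by decide⟩
  · exact ⟨110, by decide⟩
  · exact ⟨66, by decide⟩

/-- The point of `ℝ^(n+1)` with height `x` above the point `v` of `ℝ^n`. -/
noncomputable def liftPoint {n : ℕ} (x : ℝ) (v : Fin n → ℝ) : EuclideanSpace ℝ (Fin (n + 1)) :=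
  WithLp.toLp 2 (Fin.cons x v)

theorem dist_liftPoint_sq {n : ℕ} (x y : ℝ) (v w : Fin n → ℝ) :
    dist (liftPoint x v) (liftPoint y w) ^ 2 = (x - y) ^ 2 + ∑ k, (v k - w k) ^ 2 := by
  rw [EuclideanSpace.dist_eq, Real.sq_sqrt (by positivity), Fin.sum_univ_succ]
  simp [liftPoint, Real.dist_eq, sq_abs]

theorem sum_const_sub_single_sq {n : ℕ} (α β : ℝ) (k : Fin n) :
    ∑ j, (β - (Pi.single k α : Fin n → ℝ) j) ^ 2 = n * β ^ 2 - 2 * α * β + α ^ 2 := by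
  have h : ∀ j, (β - (Pi.single k α : Fin n → ℝ) j) ^ 2 =
      β ^ 2 + if j = k then α ^ 2 - 2 * α * β else 0 := by
    intro j
    by_cases hj : j = k
    · subst hj
      simp
      ring
    · simp [hj]
  simp only [h, Finset.sum_add_distrib, Finset.sum_ite_eq', Finset.mem_univ, if_true,
    Finset.sum_const, Finset.card_univ, Fintype.card_fin, nsmul_eq_mul]
  ring

theorem sum_single_sub_single_sq {n : ℕ} (α : ℝ) {k l : Fin n} (hkl : k ≠ l) :
    ∑ j, ((Pi.single k α : Fin n → ℝ) j - (Pi.single l α : Fin n → ℝ) j) ^ 2 = 2 * α ^ 2 := by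
  have h : ∀ j, ((Pi.single k α : Fin n → ℝ) j - (Pi.single l α : Fin n → ℝ) j) ^ 2 =
      (if j = k then α ^ 2 else 0) + if j = l then α ^ 2 else 0 := by
    intro j
    by_cases hj : j = k
    · subst hj
      simp [hkl]
    · by_cases hl : j = l
      · subst hl
        simp [hj]
      · simp [hj, hl]
  simp only [h, Finset.sum_add_distrib, Finset.sum_ite_eq', Finset.mem_univ, if_true]
  ring

/-- The configuration: eight points over `(β, …, β)` and two over every `α • e k`. -/
noncomputable def linePoint {n : ℕ} (α β : ℝ) :
    Fin 8 ⊕ Fin n × Fin 2 → EuclideanSpace ℝ (Fin (n + 1))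
  | .inl i => liftPoint (axisHeight i) fun _ => β
  | .inr (k, s) => liftPoint (pairHeight s) (Pi.single k α)

theorem dist_eq_intCast {X : Type*} [PseudoMetricSpace X] {p q : X} {z : ℤ} (hz : 0 ≤ z)
    (h : dist p q ^ 2 = (z : ℝ) ^ 2) : dist p q = z :=
  (pow_left_inj₀ dist_nonneg (by exact_mod_cast hz) two_ne_zero).1 h

theorem exists_dist_linePoint {n : ℕ} {α β : ℝ} (hα : α ^ 2 = 2178)
    (hβ : n * β ^ 2 - 2 * α * β + α ^ 2 = 10080) (i j : Fin 8 ⊕ Fin n × Fin 2) :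
    ∃ z : ℤ, z ≤ 158 ∧ (z = 0 → i = j) ∧ dist (linePoint α β i) (linePoint α β j) = z := by
  have cross : ∀ i k s, dist (linePoint (n := n) α β (.inl i)) (linePoint α β (.inr (k, s))) =
      crossDist i s := by
    intro i k s
    refine dist_eq_intCast (crossDist_mem i s).1.le ?_
    rw [linePoint, linePoint, dist_liftPoint_sq, sum_const_sub_single_sq, hβ]
    exact_mod_cast crossDist_sq i s
  rcases i with i | ⟨k, s⟩ <;> rcases j with j | ⟨l, t⟩
  · refine ⟨_, (axisHeight_sub_mem i j).1, fun h => congrArg _ ((axisHeight_sub_mem i j).2 h),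
      dist_eq_intCast (abs_nonneg _) ?_⟩
    rw [linePoint, linePoint, dist_liftPoint_sq]
    simp [sq_abs]
  · exact ⟨_, (crossDist_mem i t).2, fun h => absurd h (crossDist_mem i t).1.ne', cross i l t⟩
  · exact ⟨_, (crossDist_mem j s).2, fun h => absurd h (crossDist_mem j s).1.ne',
      (dist_comm _ _).trans (cross j k s)⟩
  · by_cases hkl : k = l
    · subst hkl
      refine ⟨_, (pairHeight_sub_mem s t).1, fun h => ?_, dist_eq_intCast (abs_nonneg _) ?_⟩
      · rw [(pairHeight_sub_mem s t).2 h]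
      · rw [linePoint, linePoint, dist_liftPoint_sq]
        simp [sq_abs]
    · obtain ⟨z, hz, hz', h⟩ := exists_pairHeight_sub_sq s t
      refine ⟨z, hz', fun h => absurd h hz.ne', dist_eq_intCast hz.le ?_⟩
      rw [linePoint, linePoint, dist_liftPoint_sq, sum_single_sub_single_sq α hkl, hα]
      have h' : ((pairHeight s : ℝ) - pairHeight t) ^ 2 + 66 ^ 2 = (z : ℝ) ^ 2 := by
        exact_mod_cast h
      linarith

theorem affineSpan_range_linePoint {n : ℕ} {α β : ℝ} (hα : α ≠ 0) (hβ : n * β ≠ α) :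
    affineSpan ℝ (Set.range (linePoint (n := n) α β)) = ⊤ := by
  rw [← AffineSubspace.direction_eq_top_iff_of_nonempty
    ((affineSpan_nonempty ℝ).2 (Set.range_nonempty _)), direction_affineSpan,
    ← Submodule.orthogonal_eq_bot_iff, Submodule.eq_bot_iff]
  intro w hw
  have horth : ∀ i j, inner ℝ (linePoint α β i - linePoint α β j) w = 0 := fun i j =>
    (Submodule.mem_orthogonal _ _).1 hw _
      (vsub_mem_vectorSpan ℝ (Set.mem_range_self i) (Set.mem_range_self j))
  have hzero : w 0 = 0 := by
    have h := horth (.inl 0) (.inl 1)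
    simp only [linePoint, liftPoint, PiLp.inner_apply, Fin.sum_univ_succ (n := n), axisHeight] at h
    norm_num at h
    exact h
  have hsucc : ∀ k : Fin n, α * w k.succ = β * ∑ j : Fin n, w j.succ := by
    intro k
    have h := horth (.inr (k, 0)) (.inl 0)
    simp [linePoint, liftPoint, PiLp.inner_apply, Fin.sum_univ_succ (n := n), hzero, mul_sub,
      Finset.sum_sub_distrib, Pi.single_apply, ← Finset.sum_mul] at h
    linarith
  have hsum : ∑ j : Fin n, w j.succ = 0 := by
    have h : α * ∑ j : Fin n, w j.succ = n * (β * ∑ j : Fin n, w j.succ) := by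
      rw [Finset.mul_sum, Finset.sum_congr rfl fun k _ => hsucc k]
      simp
    have h' : (n * β - α) * ∑ j : Fin n, w j.succ = 0 := by linarith
    exact (mul_eq_zero.1 h').resolve_left (sub_ne_zero.2 hβ)
  ext k
  refine Fin.cases hzero (fun k => ?_) k
  have h := hsucc k
  rw [hsum, mul_zero] at h
  exact (mul_eq_zero.1 h).resolve_left hα

theorem exists_parameters {n : ℕ} (hn : 0 < n) :
    ∃ α β : ℝ, α ^ 2 = 2178 ∧ α ≠ 0 ∧ n * β ^ 2 - 2 * α * β + α ^ 2 = 10080 ∧ n * β ≠ α := by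
  have hn' : (0 : ℝ) < n := by exact_mod_cast hn
  have hα : √(2178 : ℝ) ^ 2 = 2178 := Real.sq_sqrt (by norm_num)
  have hpos : (0 : ℝ) < 2178 + n * 7902 := by positivity
  have hδ : √(2178 + n * 7902 : ℝ) ^ 2 = 2178 + n * 7902 := Real.sq_sqrt hpos.le
  refine ⟨√2178, (√2178 + √(2178 + n * 7902)) / n, hα, by positivity, ?_, ?_⟩
  · field_simp
    linear_combination hδ + (n - 1 : ℝ) * hα
  · rw [mul_div_cancel₀ _ hn'.ne']
    exact (lt_add_of_pos_right _ (Real.sqrt_pos.2 hpos)).ne'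

end IntegralPointSet

/-- For every integer `m ≥ 2`, there exists an integral point set of `2 * m + 6` points in
`ℝ^m` (pairwise integral distances, not contained in any affine hyperplane) whose
diameter is at most `158`; that is, `d(m, 2 * m + 6) ≤ 158`. -/
theorem d_bound_stmt_8 :
    ∀ m : ℕ, 2 ≤ m →
      ∃ S : Finset (EuclideanSpace ℝ (Fin m)),
        S.card = 2 * m + 6 ∧
        affineSpan ℝ (S : Set (EuclideanSpace ℝ (Fin m))) = ⊤ ∧
        (∀ p ∈ S, ∀ q ∈ S, ∃ z : ℤ, dist p q = (z : ℝ)) ∧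
        Metric.diam (S : Set (EuclideanSpace ℝ (Fin m))) ≤ 158 := by
  intro m hm
  obtain ⟨n, rfl⟩ : ∃ n, m = n + 1 := ⟨m - 1, by lia⟩
  obtain ⟨α, β, hα, hα0, hβ, hβα⟩ := IntegralPointSet.exists_parameters (n := n) (by lia)
  have hdist := IntegralPointSet.exists_dist_linePoint hα hβ
  have hinj : Function.Injective (IntegralPointSet.linePoint (n := n) α β) := by
    intro i j hij
    obtain ⟨z, -, hz, h⟩ := hdist i j
    rw [hij, dist_self] at h
    exact hz (by exact_mod_cast h.symm)
  refine ⟨Finset.univ.map ⟨_, hinj⟩, ?_, ?_, ?_, ?_⟩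
  · simp
    ring
  · simpa using IntegralPointSet.affineSpan_range_linePoint hα0 hβα
  · simp only [Finset.mem_map, Finset.mem_univ, true_and, Function.Embedding.coeFn_mk]
    rintro _ ⟨i, rfl⟩ _ ⟨j, rfl⟩
    obtain ⟨z, -, -, h⟩ := hdist i j
    exact ⟨z, h⟩
  · refine Metric.diam_le_of_forall_dist_le (by norm_num) ?_
    simp only [Finset.mem_coe, Finset.mem_map, Finset.mem_univ, true_and,
      Function.Embedding.coeFn_mk]
    rintro _ ⟨i, rfl⟩ _ ⟨j, rfl⟩
    obtain ⟨z, hz, -, h⟩ := hdist i j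
    rw [h]
    exact_mod_cast hz
end

section
/- For every integer m ≥ 2, d(m, 2m + 8) ≤ 297; that is, there exists an integral point set of 2m + 8 points in m-dimensional Euclidean space ℝ^m whose diameter is at most 297. -/
/-- The point of `ℝ^(k+1)` with first coordinate `x` and remaining coordinates `v`. -/
noncomputable def consPoint {k : ℕ} (x : ℝ) (v : Fin k → ℝ) : EuclideanSpace ℝ (Fin (k + 1)) :=
  WithLp.toLp 2 (Fin.cons x v : Fin (k + 1) → ℝ)

theorem dist_consPoint_sq {k : ℕ} (x y : ℝ) (v w : Fin k → ℝ) :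
    dist (consPoint x v) (consPoint y w) ^ 2 = (x - y) ^ 2 + ∑ j, (v j - w j) ^ 2 := by
  rw [EuclideanSpace.dist_eq, Real.sq_sqrt (Finset.sum_nonneg fun _ _ => sq_nonneg _),
    Fin.sum_univ_succ]
  simp [consPoint, Real.dist_eq, sq_abs]

/-- The `i`-th vertex `s • eᵢ + t • (1, …, 1)` of a regular simplex. -/
def simplexVertex {k : ℕ} (s t : ℝ) (i : Fin k) : Fin k → ℝ :=
  fun j => t + if i = j then s else 0

theorem sum_simplexVertex_sq {k : ℕ} (s t : ℝ) (i : Fin k) :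
    ∑ j, simplexVertex s t i j ^ 2 = k * t ^ 2 + 2 * s * t + s ^ 2 := by
  have h : ∀ j, simplexVertex s t i j ^ 2 = t ^ 2 + if i = j then 2 * s * t + s ^ 2 else 0 := by
    intro j
    unfold simplexVertex
    split_ifs <;> ring
  simp only [h, Finset.sum_add_distrib, Finset.sum_ite_eq, Finset.mem_univ, if_true,
    Finset.sum_const, Finset.card_univ, Fintype.card_fin, nsmul_eq_mul]
  ring

theorem sum_simplexVertex_sub_sq {k : ℕ} (s t : ℝ) {i i' : Fin k} (hi : i ≠ i') :
    ∑ j, (simplexVertex s t i j - simplexVertex s t i' j) ^ 2 = 2 * s ^ 2 := by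
  have h : ∀ j, (simplexVertex s t i j - simplexVertex s t i' j) ^ 2 =
      (if i = j then s ^ 2 else 0) + if i' = j then s ^ 2 else 0 := by
    intro j
    unfold simplexVertex
    by_cases h₁ : i = j <;> by_cases h₂ : i' = j
    · exact absurd (h₁.trans h₂.symm) hi
    all_goals simp [h₁, h₂]
  simp only [h, Finset.sum_add_distrib, Finset.sum_ite_eq, Finset.mem_univ, if_true]
  ring

theorem exists_simplex_parameters {k : ℕ} (hk : 0 < k) :
    ∃ s t : ℝ, s ≠ 0 ∧ s + k * t ≠ 0 ∧ 2 * s ^ 2 = 400 ∧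
      k * t ^ 2 + 2 * s * t + s ^ 2 = 10080 := by
  have hk' : (k : ℝ) ≠ 0 := by positivity
  have hs : √(200 : ℝ) ^ 2 = 200 := Real.sq_sqrt (by norm_num)
  have hr : √(200 + 9880 * k : ℝ) ^ 2 = 200 + 9880 * k := Real.sq_sqrt (by positivity)
  refine ⟨√200, (√(200 + 9880 * k) - √200) / k, by positivity, ?_, by rw [hs]; norm_num, ?_⟩
  · rw [mul_div_cancel₀ _ hk', add_sub_cancel]
    positivity
  · generalize √(200 + 9880 * k : ℝ) = r at hr ⊢
    field_simp
    linear_combination hr - hs + k * hs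

/-- Positions of the ten collinear points. -/
def linePosition : Fin 10 → ℤ := ![-99, -54, -23, 18, 37, 62, 81, 122, 153, 198]

/-- Positions of the feet of the two parallel simplices on the line. -/
def footPosition : Fin 2 → ℤ := ![0, 99]

/-- Distances from the collinear points to the vertices of the two simplices. -/
def lineSimplexDist : Fin 2 → Fin 10 → ℕ :=
  ![![141, 114, 103, 102, 107, 118, 129, 158, 183, 222],
    ![222, 183, 158, 129, 118, 107, 102, 103, 114, 141]]

theorem lineSimplexDist_spec : ∀ b i, 0 < lineSimplexDist b i ∧ lineSimplexDist b i ≤ 297 ∧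
    (linePosition i - footPosition b) ^ 2 + 10080 = (lineSimplexDist b i : ℤ) ^ 2 := by
  decide

theorem linePosition_spec : ∀ i j, i ≠ j → 0 < (linePosition i - linePosition j).natAbs ∧
    (linePosition i - linePosition j).natAbs ≤ 297 := by
  decide

theorem footPosition_spec : ∀ b c, b ≠ c → (footPosition b - footPosition c) ^ 2 = 9801 := by
  decide

/-- Ten points on a line together with two translates of a regular simplex orthogonal to it. -/
noncomputable def linePrismPoint {k : ℕ} (s t : ℝ) :
    Fin 10 ⊕ (Fin 2 × Fin k) → EuclideanSpace ℝ (Fin (k + 1))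
  | .inl i => consPoint (linePosition i) 0
  | .inr (b, i) => consPoint (footPosition b) (simplexVertex s t i)

theorem dist_linePrismPoint {k : ℕ} {s t : ℝ} (hs : 2 * s ^ 2 = 400)
    (ht : k * t ^ 2 + 2 * s * t + s ^ 2 = 10080) {p q : Fin 10 ⊕ (Fin 2 × Fin k)} (hpq : p ≠ q) :
    ∃ n : ℕ, 0 < n ∧ n ≤ 297 ∧ dist (linePrismPoint s t p) (linePrismPoint s t q) = n := by
  suffices h : ∃ n : ℕ, 0 < n ∧ n ≤ 297 ∧
      dist (linePrismPoint s t p) (linePrismPoint s t q) ^ 2 = (n : ℝ) ^ 2 by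
    obtain ⟨n, h₀, h₁, h₂⟩ := h
    exact ⟨n, h₀, h₁, (sq_eq_sq₀ dist_nonneg n.cast_nonneg).1 h₂⟩
  have hmixed : ∀ (i : Fin 10) (c : Fin 2 × Fin k), ∃ n : ℕ, 0 < n ∧ n ≤ 297 ∧
      dist (linePrismPoint s t (.inl i)) (linePrismPoint s t (.inr c)) ^ 2 = (n : ℝ) ^ 2 := by
    rintro i ⟨b, j⟩
    obtain ⟨h₀, h₁, h₂⟩ := lineSimplexDist_spec b i
    refine ⟨_, h₀, h₁, ?_⟩
    simp only [linePrismPoint, dist_consPoint_sq, Pi.zero_apply, zero_sub, neg_sq,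
      sum_simplexVertex_sq, ht]
    exact_mod_cast h₂
  rcases p with i | ⟨b, i⟩ <;> rcases q with j | ⟨c, j⟩
  · obtain ⟨h₀, h₁⟩ := linePosition_spec i j (by simpa using hpq)
    refine ⟨_, h₀, h₁, ?_⟩
    simp [linePrismPoint, dist_consPoint_sq, Nat.cast_natAbs]
  · exact hmixed i (c, j)
  · rw [dist_comm]
    exact hmixed j (b, i)
  · simp only [linePrismPoint, dist_consPoint_sq]
    by_cases hij : i = j
    · subst hij
      have hbc : ((footPosition b : ℝ) - footPosition c) ^ 2 = 9801 := by
        exact_mod_cast footPosition_spec b c (by simpa using hpq)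
      exact ⟨99, by norm_num, by norm_num, by simp [hbc]; norm_num⟩
    · rw [sum_simplexVertex_sub_sq s t hij, hs]
      by_cases hbc : b = c
      · exact ⟨20, by norm_num, by norm_num, by simp [hbc]; norm_num⟩
      · have h : ((footPosition b : ℝ) - footPosition c) ^ 2 = 9801 := by
          exact_mod_cast footPosition_spec b c hbc
        exact ⟨101, by norm_num, by norm_num, by rw [h]; norm_num⟩

theorem affineSpan_range_linePrismPoint {k : ℕ} {s t : ℝ} (hs : s ≠ 0) (hst : s + k * t ≠ 0) :
    affineSpan ℝ (Set.range (linePrismPoint (k := k) s t)) = ⊤ := by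
  rw [AffineSubspace.affineSpan_eq_top_iff_vectorSpan_eq_top_of_nonempty _ _ _
    (Set.range_nonempty _), ← Submodule.orthogonal_eq_bot_iff, Submodule.eq_bot_iff]
  intro w hw
  have horth : ∀ p q, inner ℝ (linePrismPoint s t p - linePrismPoint s t q) w = 0 := fun p q =>
    (Submodule.mem_orthogonal _ _).1 hw _
      (vsub_mem_vectorSpan ℝ (Set.mem_range_self p) (Set.mem_range_self q))
  have hzero : w 0 = 0 := by
    have h := horth (.inl 9) (.inl 0)
    simp [PiLp.inner_apply, Fin.sum_univ_succ, linePrismPoint, consPoint, linePosition] at h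
    norm_num at h
    exact h
  have hsucc : ∀ i : Fin k, s * w i.succ + t * ∑ j : Fin k, w j.succ = 0 := by
    intro i
    have h := horth (.inr (0, i)) (.inl 0)
    simp [PiLp.inner_apply, Fin.sum_univ_succ, linePrismPoint, consPoint, simplexVertex, hzero,
      mul_add, Finset.sum_add_distrib, ← Finset.sum_mul] at h
    linarith
  have hsum : ∑ j : Fin k, w j.succ = 0 := by
    have h := Finset.sum_eq_zero fun i (_ : i ∈ Finset.univ) => hsucc i
    rw [Finset.sum_add_distrib, ← Finset.mul_sum, Finset.sum_const, Finset.card_univ,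
      Fintype.card_fin, nsmul_eq_mul] at h
    refine (mul_eq_zero.1 ?_).resolve_left hst
    linear_combination h
  ext i
  refine Fin.cases hzero (fun j => ?_) i
  simpa [hsum, hs] using hsucc j

/-- For every integer `m ≥ 2`, there exists an integral point set of `2 * m + 8` points in
`ℝ^m` (pairwise integral distances, not contained in any affine hyperplane) whose
diameter is at most `297`; that is, `d(m, 2 * m + 8) ≤ 297`. -/
theorem d_bound_stmt_10 :
    ∀ m : ℕ, 2 ≤ m →
      ∃ S : Finset (EuclideanSpace ℝ (Fin m)),
        S.card = 2 * m + 8 ∧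
        affineSpan ℝ (S : Set (EuclideanSpace ℝ (Fin m))) = ⊤ ∧
        (∀ p ∈ S, ∀ q ∈ S, ∃ z : ℤ, dist p q = (z : ℝ)) ∧
        Metric.diam (S : Set (EuclideanSpace ℝ (Fin m))) ≤ 297 := by
  intro m hm
  obtain ⟨k, rfl⟩ : ∃ k, m = k + 1 := ⟨m - 1, by omega⟩
  obtain ⟨s, t, hs, hst, hs', ht⟩ := exists_simplex_parameters (k := k) (by omega)
  have hdist : ∀ p q, ∃ n : ℕ, n ≤ 297 ∧
      dist (linePrismPoint s t p) (linePrismPoint (k := k) s t q) = n := by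
    intro p q
    by_cases hpq : p = q
    · exact ⟨0, by norm_num, by simp [hpq]⟩
    · obtain ⟨n, -, h⟩ := dist_linePrismPoint hs' ht hpq
      exact ⟨n, h⟩
  have hinj : Function.Injective (linePrismPoint (k := k) s t) := by
    intro p q h
    by_contra hpq
    obtain ⟨n, h₀, -, h₁⟩ := dist_linePrismPoint hs' ht hpq
    rw [h, dist_self] at h₁
    exact h₀.ne (by exact_mod_cast h₁)
  refine ⟨Finset.univ.map ⟨_, hinj⟩, ?_, ?_, ?_, ?_⟩
  · simp
    ring
  · simpa using affineSpan_range_linePrismPoint hs hst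
  · simp only [Finset.mem_map, Finset.mem_univ, true_and, Function.Embedding.coeFn_mk]
    rintro _ ⟨p, rfl⟩ _ ⟨q, rfl⟩
    obtain ⟨n, -, h⟩ := hdist p q
    exact ⟨n, by simpa using h⟩
  · refine Metric.diam_le_of_forall_dist_le (by norm_num) ?_
    simp only [Finset.coe_map, Finset.coe_univ, Set.image_univ, Function.Embedding.coeFn_mk]
    rintro _ ⟨p, rfl⟩ _ ⟨q, rfl⟩
    obtain ⟨n, h₀, h⟩ := hdist p q
    rw [h]
    exact_mod_cast h₀
end

section
/- For every integer m ≥ 2, d(m, 2m + 11) ≤ 1888; that is, there exists an integral point set of 2m + 11 points in m-dimensional Euclidean space ℝ^m whose diameter is at most 1888. -/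
/-- The point above the `i`-th vertex of a regular `(m - 1)`-simplex of edge length `120`,
at height `h` in the direction normal to the simplex. -/
noncomputable def prismPoint {m : ℕ} (p : Fin m × ℤ) : EuclideanSpace ℝ (Fin m) :=
  (120 / √2) • EuclideanSpace.single p.1 1 + ((p.2 : ℝ) / √m) • WithLp.toLp 2 (fun _ => 1)

theorem prismPoint_apply {m : ℕ} (p : Fin m × ℤ) (k : Fin m) :
    prismPoint p k = (if k = p.1 then 120 / √2 else 0) + (p.2 : ℝ) / √m := by
  simp [prismPoint]

theorem dist_sq_prismPoint {m : ℕ} (hm : 0 < m) (p q : Fin m × ℤ) :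
    dist (prismPoint p) (prismPoint q) ^ 2
      = (if p.1 = q.1 then 0 else 14400) + ((p.2 : ℝ) - q.2) ^ 2 := by
  obtain ⟨i, h⟩ := p
  obtain ⟨j, k⟩ := q
  have hs : √(m : ℝ) ^ 2 = m := Real.sq_sqrt (Nat.cast_nonneg m)
  have hs0 : √(m : ℝ) ≠ 0 := by positivity
  have h2 : (120 / √2 : ℝ) ^ 2 = 7200 := by
    rw [div_pow, Real.sq_sqrt (by norm_num)]; norm_num
  set c : ℝ := 120 / √2
  set d : ℝ := h / √m - k / √m with hd
  have hd2 : m * d ^ 2 = ((h : ℝ) - k) ^ 2 := by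
    rw [hd, ← sub_div, div_pow, hs]
    field_simp
  have expand : ∀ l : Fin m, dist (prismPoint (i, h) l) (prismPoint (j, k) l) ^ 2
      = (if l = i then c ^ 2 + 2 * c * d else 0) + (if l = j then c ^ 2 - 2 * c * d else 0)
        - (if l = i then (if i = j then 2 * c ^ 2 else 0) else 0) + d ^ 2 := by
    intro l
    rw [Real.dist_eq, sq_abs, prismPoint_apply, prismPoint_apply]
    dsimp only
    split_ifs <;> grind
  rw [EuclideanSpace.dist_eq, Real.sq_sqrt (by positivity),
    Finset.sum_congr rfl fun l _ => expand l]
  simp only [Finset.sum_add_distrib, Finset.sum_sub_distrib, Finset.sum_ite_eq', Finset.mem_univ,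
    if_true, Finset.sum_const, Finset.card_univ, Fintype.card_fin, nsmul_eq_mul]
  split_ifs <;> linarith

theorem prismPoint_injective {m : ℕ} (hm : 0 < m) :
    Function.Injective (prismPoint : Fin m × ℤ → EuclideanSpace ℝ (Fin m)) := by
  intro p q hpq
  have h := dist_sq_prismPoint hm p q
  rw [hpq, dist_self] at h
  split_ifs at h with h1
  · refine Prod.ext h1 ?_
    have : ((p.2 : ℝ) - q.2) = 0 := by
      exact (pow_eq_zero_iff two_ne_zero).mp (by linarith)
    exact_mod_cast sub_eq_zero.mp this
  · nlinarith [sq_nonneg ((p.2 : ℝ) - q.2)]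

/-- A base simplex together with one point outside its hyperplane affinely spans the space. -/
theorem affineSpan_prismPoint_eq_top {m : ℕ} (I : Set (Fin m × ℤ)) (base : ∀ i, (i, 0) ∈ I)
    (i₀ : Fin m) (h₀ : ℤ) (hh₀ : h₀ ≠ 0) (apex : (i₀, h₀) ∈ I) :
    affineSpan ℝ (prismPoint '' I) = ⊤ := by
  have hm : 0 < m := i₀.pos
  have hne : (prismPoint '' I).Nonempty := ⟨_, _, apex, rfl⟩
  rw [AffineSubspace.affineSpan_eq_top_iff_vectorSpan_eq_top_of_nonempty ℝ _ _ hne]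
  set V := vectorSpan ℝ (prismPoint '' I)
  have hsub : ∀ p ∈ I, ∀ q ∈ I, prismPoint p - prismPoint q ∈ V := fun p hp q hq =>
    vsub_mem_vectorSpan ℝ ⟨p, hp, rfl⟩ ⟨q, hq, rfl⟩
  have hs0 : √(m : ℝ) ≠ 0 := by positivity
  have hones : (WithLp.toLp 2 (fun _ => 1) : EuclideanSpace ℝ (Fin m)) ∈ V := by
    have h := hsub _ apex _ (base i₀)
    have hne' : (h₀ : ℝ) / √m ≠ 0 := div_ne_zero (by exact_mod_cast hh₀) hs0
    refine (V.smul_mem_iff hne').mp ?_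
    simpa [prismPoint] using h
  have hsingle : ∀ i j : Fin m,
      (EuclideanSpace.single i 1 - EuclideanSpace.single j 1 : EuclideanSpace ℝ (Fin m)) ∈ V := by
    intro i j
    have h := hsub _ (base i) _ (base j)
    have hne' : (120 / √2 : ℝ) ≠ 0 := by positivity
    refine (V.smul_mem_iff hne').mp ?_
    simpa [prismPoint, smul_sub] using h
  have hbasis : ∀ i : Fin m, (EuclideanSpace.single i 1 : EuclideanSpace ℝ (Fin m)) ∈ V := by
    intro i
    have h := V.add_mem (V.sum_mem fun j (_ : j ∈ Finset.univ) => hsingle i j) hones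
    refine (V.smul_mem_iff (show (m : ℝ) ≠ 0 by positivity)).mp ?_
    convert h using 1
    ext l
    simp [Pi.single_apply]
  rw [eq_top_iff]
  intro x _
  rw [← (EuclideanSpace.basisFun (Fin m) ℝ).sum_repr x]
  exact V.sum_mem fun i _ => V.smul_mem _ (by simpa using hbasis i)

/-- An index set of sufficiently many prism points with admissible height differences contains
one giving an integral point set of exactly `n` points. -/
theorem exists_integral_pointSet {m n : ℕ} (I : Finset (Fin m × ℤ)) (base : ∀ i, (i, 0) ∈ I)
    (i₀ : Fin m) (h₀ : ℤ) (hh₀ : h₀ ≠ 0) (apex : (i₀, h₀) ∈ I) {D : ℕ}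
    (integral : ∀ p ∈ I, ∀ q ∈ I, ∃ z : ℕ, z ≤ D ∧
      (z : ℤ) ^ 2 = (if p.1 = q.1 then 0 else 14400) + (p.2 - q.2) ^ 2)
    (hn : m + 1 ≤ n) (hcard : n ≤ I.card) :
    ∃ S : Finset (EuclideanSpace ℝ (Fin m)),
      S.card = n ∧ affineSpan ℝ (S : Set (EuclideanSpace ℝ (Fin m))) = ⊤ ∧
      (∀ p ∈ S, ∀ q ∈ S, ∃ z : ℤ, dist p q = (z : ℝ)) ∧
      Metric.diam (S : Set (EuclideanSpace ℝ (Fin m))) ≤ D := by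
  have hm : 0 < m := i₀.pos
  let B : Finset (Fin m × ℤ) := insert (i₀, h₀) (Finset.univ.image fun i => (i, 0))
  have hB : B.card ≤ n := (Finset.card_insert_le _ _).trans
    ((Nat.succ_le_succ (Finset.card_image_le.trans (by simp))).trans hn)
  have hBI : B ⊆ I := by
    intro p hp
    simp only [B, Finset.mem_insert, Finset.mem_image, Finset.mem_univ, true_and] at hp
    rcases hp with rfl | ⟨i, rfl⟩
    exacts [apex, base i]
  obtain ⟨J, hBJ, hJI, rfl⟩ := Finset.exists_subsuperset_card_eq hBI hB hcard
  have hdist : ∀ p ∈ J, ∀ q ∈ J, ∃ z : ℕ, z ≤ D ∧ dist (prismPoint p) (prismPoint q) = z := by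
    intro p hp q hq
    obtain ⟨z, hz, h⟩ := integral p (hJI hp) q (hJI hq)
    refine ⟨z, hz, ?_⟩
    rw [← sq_eq_sq₀ dist_nonneg (Nat.cast_nonneg z), dist_sq_prismPoint hm]
    exact_mod_cast h.symm
  refine ⟨J.image prismPoint, Finset.card_image_of_injective _ (prismPoint_injective hm), ?_, ?_, ?_⟩
  · rw [Finset.coe_image]
    exact affineSpan_prismPoint_eq_top _ (fun i => hBJ (by simp [B])) i₀ h₀ hh₀ (hBJ (by simp [B]))
  · simp only [Finset.forall_mem_image]
    intro p hp q hq
    obtain ⟨z, -, h⟩ := hdist p hp q hq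
    exact ⟨z, by simpa using h⟩
  · refine Metric.diam_le_of_forall_dist_le (Nat.cast_nonneg D) ?_
    simp only [Finset.mem_coe, Finset.forall_mem_image]
    intro p hp q hq
    obtain ⟨z, hz, h⟩ := hdist p hp q hq
    rw [h]
    exact_mod_cast hz

/-- Nonzero integers `h` with `120 ^ 2 + h ^ 2` a perfect square. -/
def legHeights : Finset ℤ :=
  {22, 27, 35, 50, 64, 90, 119, 126, 160, 182, 209,
    -22, -27, -35, -50, -64, -90, -119, -126, -160, -182, -209}

theorem exists_sq_of_mem_legHeights :
    ∀ h ∈ legHeights, h ≠ 0 ∧ -209 ≤ h ∧ h ≤ 209 ∧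
      ∃ z : ℕ, z ≤ 241 ∧ (z : ℤ) ^ 2 = 14400 + h ^ 2 := by
  decide +kernel

/-- For every integer `m ≥ 2`, there exists an integral point set of `2 * m + 11` points in
`ℝ^m` (pairwise integral distances, not contained in any affine hyperplane) whose
diameter is at most `1888`; that is, `d(m, 2 * m + 11) ≤ 1888`. -/
theorem d_bound_stmt_13 :
    ∀ m : ℕ, 2 ≤ m →
      ∃ S : Finset (EuclideanSpace ℝ (Fin m)),
        S.card = 2 * m + 11 ∧
        affineSpan ℝ (S : Set (EuclideanSpace ℝ (Fin m))) = ⊤ ∧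
        (∀ p ∈ S, ∀ q ∈ S, ∃ z : ℤ, dist p q = (z : ℝ)) ∧
        Metric.diam (S : Set (EuclideanSpace ℝ (Fin m))) ≤ 1888 := by
  intro m hm
  have : NeZero m := ⟨by omega⟩
  rcases le_total m 11 with hm' | hm'
  · let J : Finset (Fin m × ℤ) := Finset.univ ×ˢ {0}
    let K : Finset (Fin m × ℤ) := {0} ×ˢ legHeights
    have hdisj : Disjoint J K := by
      refine Finset.disjoint_product.mpr (Or.inr ?_)
      rw [Finset.disjoint_singleton_left]
      exact fun h => (exists_sq_of_mem_legHeights 0 h).1 rfl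
    have hcard : (J ∪ K).card = m + 22 := by
      rw [Finset.card_union_of_disjoint hdisj, Finset.card_product, Finset.card_product,
        Finset.card_univ, Fintype.card_fin, Finset.card_singleton, Finset.card_singleton,
        mul_one, one_mul]
      rfl
    refine exists_integral_pointSet (D := 1888) (J ∪ K) (fun i => by simp [J]) 0 22 (by norm_num)
      (by simp [K, legHeights]) ?_ (by omega) (by omega)
    rintro ⟨i, h⟩ hp ⟨j, k⟩ hq
    simp only [J, K, Finset.mem_union, Finset.mem_product, Finset.mem_univ, true_and,
      Finset.mem_singleton] at hp hq ⊢
    split_ifs with hij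
    · refine ⟨(h - k).natAbs, ?_, by simp⟩
      have hb : ∀ (i : Fin m) (h : ℤ), h = 0 ∨ i = 0 ∧ h ∈ legHeights → -209 ≤ h ∧ h ≤ 209 := by
        rintro i h (rfl | ⟨-, hh⟩)
        · norm_num
        · exact ⟨(exists_sq_of_mem_legHeights h hh).2.1, (exists_sq_of_mem_legHeights h hh).2.2.1⟩
      have := hb i h hp
      have := hb j k hq
      omega
    · rcases hp with rfl | ⟨rfl, hh⟩ <;> rcases hq with rfl | ⟨rfl, hk⟩
      · exact ⟨120, by norm_num⟩
      · obtain ⟨-, -, -, z, hz, hz2⟩ := exists_sq_of_mem_legHeights k hk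
        exact ⟨z, by omega, by simpa using hz2⟩
      · obtain ⟨-, -, -, z, hz, hz2⟩ := exists_sq_of_mem_legHeights h hh
        exact ⟨z, by omega, by simpa using hz2⟩
      · exact absurd rfl hij
  · let I : Finset (Fin m × ℤ) := Finset.univ ×ˢ {0, 182, 209}
    have hcard : I.card = m * 3 := by
      rw [Finset.card_product, Finset.card_univ, Fintype.card_fin]
      rfl
    refine exists_integral_pointSet (D := 1888) I (fun i => by simp [I]) 0 182 (by norm_num)
      (by simp [I]) ?_ (by omega) (by omega)
    rintro ⟨i, h⟩ hp ⟨j, k⟩ hq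
    simp only [I, Finset.mem_product, Finset.mem_univ, true_and, Finset.mem_singleton,
      Finset.mem_insert] at hp hq ⊢
    split_ifs with hij
    · refine ⟨(h - k).natAbs, by omega, by simp⟩
    · have hleg : h - k = 0 ∨ h - k ∈ legHeights := by
        rcases hp with rfl | rfl | rfl <;> rcases hq with rfl | rfl | rfl <;> decide
      rcases hleg with h0 | hleg
      · exact ⟨120, by norm_num [h0]⟩
      · obtain ⟨-, -, -, z, hz, hz2⟩ := exists_sq_of_mem_legHeights _ hleg
        exact ⟨z, by omega, hz2⟩
end

section
/- For every integer m ≥ 2, d(m, 2m + 16) ≤ 6586; that is, there exists an integral point set of 2m + 16 points in m-dimensional Euclidean space ℝ^m whose diameter is at most 6586. -/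
/-- Heights of the eighteen collinear points. -/
def axisHeight : Fin 18 → ℤ :=
  ![-2419, -974, -502, -162, -25, 25, 261, 298, 774,
    974, 1450, 1487, 1723, 1773, 1910, 2250, 2722, 4167]

/-- Distances from the collinear points to any simplex vertex at height `0`. -/
def axisDist : Fin 18 → ℕ :=
  ![2531, 1226, 898, 762, 745, 745, 789, 802, 1074,
    1226, 1630, 1663, 1877, 1923, 2050, 2370, 2822, 4233]

/-- The heights `0` and `1748` of the two translated simplices. -/
def prismHeight : Fin 2 → ℤ := ![0, 1748]

/-- Distances from the collinear points to the vertices of the two simplices. -/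
def prismAxisDist (b : Fin 2) (k : Fin 18) : ℕ :=
  if b = 0 then axisDist k else axisDist k.rev

theorem prismAxisDist_sq : ∀ b k,
    (prismAxisDist b k : ℤ) ^ 2 = (prismHeight b - axisHeight k) ^ 2 + 554400 := by
  decide

theorem prismAxisDist_pos_le : ∀ b k, 0 < prismAxisDist b k ∧ prismAxisDist b k ≤ 6586 := by
  decide

theorem axisHeight_sub_le : ∀ k l, (axisHeight k - axisHeight l).natAbs ≤ 6586 := by
  decide

theorem axisHeight_injective : Function.Injective axisHeight := by
  decide

/-- Distances between vertices of the two simplices above distinct base points. -/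
def prismDist (b b' : Fin 2) : ℕ := if b = b' then 336 else 1780

theorem prismDist_sq : ∀ b b',
    (prismDist b b' : ℤ) ^ 2 = (prismHeight b - prismHeight b') ^ 2 + 112896 := by
  decide

/-- The point of `ℝ ^ (n + 1)` with height `h` above the base point `w`. -/
noncomputable def liftPoint {n : ℕ} (h : ℝ) (w : Fin n → ℝ) : EuclideanSpace ℝ (Fin (n + 1)) :=
  WithLp.toLp 2 (Fin.cons h w)

theorem dist_liftPoint_sq {n : ℕ} (h h' : ℝ) (w w' : Fin n → ℝ) :
    dist (liftPoint h w) (liftPoint h' w') ^ 2 = (h - h') ^ 2 + ∑ i, (w i - w' i) ^ 2 := by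
  rw [EuclideanSpace.dist_sq_eq, Fin.sum_univ_succ]
  simp [liftPoint, Real.dist_eq, sq_abs]

theorem dist_liftPoint_eq {n : ℕ} {h h' : ℝ} {w w' : Fin n → ℝ} {z : ℕ}
    (hz : (h - h') ^ 2 + ∑ i, (w i - w' i) ^ 2 = (z : ℝ) ^ 2) :
    dist (liftPoint h w) (liftPoint h' w') = z := by
  rw [← dist_liftPoint_sq] at hz
  exact (sq_eq_sq₀ dist_nonneg (Nat.cast_nonneg z)).1 hz

theorem sum_single_sub_const_sq {n : ℕ} (t c : ℝ) (i : Fin n) :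
    ∑ l, ((Pi.single i t : Fin n → ℝ) l - c) ^ 2 = t ^ 2 - 2 * t * c + n * c ^ 2 := by
  have h : ∀ l, ((Pi.single i t : Fin n → ℝ) l - c) ^ 2
      = (Pi.single i (t ^ 2 - 2 * t * c) : Fin n → ℝ) l + c ^ 2 := by
    intro l
    rcases eq_or_ne l i with rfl | hl
    · simp only [Pi.single_eq_same]; ring
    · simp [Pi.single_eq_of_ne hl]
  simp [h, Finset.sum_add_distrib]

theorem sum_single_sub_single_sq {n : ℕ} (t : ℝ) {i j : Fin n} (hij : i ≠ j) :
    ∑ l, ((Pi.single i t : Fin n → ℝ) l - (Pi.single j t : Fin n → ℝ) l) ^ 2 = 2 * t ^ 2 := by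
  have h : ∀ l, ((Pi.single i t : Fin n → ℝ) l - (Pi.single j t : Fin n → ℝ) l) ^ 2
      = (Pi.single i (t ^ 2) : Fin n → ℝ) l + (Pi.single j (t ^ 2) : Fin n → ℝ) l := by
    intro l
    rcases eq_or_ne l i with rfl | hl
    · simp [Pi.single_eq_of_ne hij]
    · rcases eq_or_ne l j with rfl | hl'
      · simp [Pi.single_eq_of_ne hl]
      · simp [Pi.single_eq_of_ne hl, Pi.single_eq_of_ne hl']
  simp only [h, Finset.sum_add_distrib, Finset.sum_pi_single',
    Finset.mem_univ, if_true]
  ring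

/-- The base point `(c, …, c)` can be chosen at squared distance `554400` from the points `t • eᵢ`,
which have pairwise distance `336`, and outside of the hyperplane through them. -/
theorem exists_base_parameters {n : ℕ} (hn : 0 < n) :
    ∃ t c : ℝ, t ^ 2 = 56448 ∧ t ^ 2 - 2 * t * c + n * c ^ 2 = 554400 ∧ t - n * c ≠ 0 := by
  have hn' : (0 : ℝ) < n := Nat.cast_pos.2 hn
  have ht : √(56448 : ℝ) ^ 2 = 56448 := Real.sq_sqrt (by norm_num)
  have hr : √(56448 + 497952 * n : ℝ) ^ 2 = 56448 + 497952 * n := Real.sq_sqrt (by positivity)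
  have hr0 : 0 < √(56448 + 497952 * n : ℝ) := Real.sqrt_pos.2 (by positivity)
  set t := √(56448 : ℝ)
  set r := √(56448 + 497952 * n : ℝ)
  refine ⟨t, (t + r) / n, ht, ?_, ?_⟩
  · field_simp
    linear_combination (n - 1) * ht + hr
  · rw [mul_div_cancel₀ _ hn'.ne']
    linarith

/-- Two translated regular simplices with `n` vertices each, together with eighteen points on a
common line orthogonal to both. -/
noncomputable def prismAxisPoint (n : ℕ) (t c : ℝ) :
    (Fin n × Fin 2) ⊕ Fin 18 → EuclideanSpace ℝ (Fin (n + 1))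
  | .inl (i, b) => liftPoint (prismHeight b) (Pi.single i t)
  | .inr k => liftPoint (axisHeight k) (fun _ => c)

theorem dist_prism_axis {n : ℕ} {t c : ℝ}
    (hc : t ^ 2 - 2 * t * c + n * c ^ 2 = 554400) (i : Fin n) (b : Fin 2) (k : Fin 18) :
    dist (prismAxisPoint n t c (.inl (i, b))) (prismAxisPoint n t c (.inr k))
      = prismAxisDist b k := by
  apply dist_liftPoint_eq
  rw [sum_single_sub_const_sq, hc]
  exact_mod_cast (prismAxisDist_sq b k).symm

theorem dist_prismAxisPoint {n : ℕ} {t c : ℝ} (ht : t ^ 2 = 56448)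
    (hc : t ^ 2 - 2 * t * c + n * c ^ 2 = 554400) {x y : (Fin n × Fin 2) ⊕ Fin 18} (hxy : x ≠ y) :
    ∃ z : ℕ, dist (prismAxisPoint n t c x) (prismAxisPoint n t c y) = z ∧ 0 < z ∧ z ≤ 6586 := by
  match x, y with
  | .inl (i, b), .inl (j, b') =>
    rcases eq_or_ne i j with rfl | hij
    · have hb : b ≠ b' := by rintro rfl; exact hxy rfl
      refine ⟨1748, ?_, by norm_num, by norm_num⟩
      apply dist_liftPoint_eq
      fin_cases b <;> fin_cases b' <;> simp_all [prismHeight]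
    · refine ⟨prismDist b b', ?_, ?_⟩
      · apply dist_liftPoint_eq
        rw [sum_single_sub_single_sq t hij, ht, show (2 * 56448 : ℝ) = 112896 by norm_num]
        exact_mod_cast (prismDist_sq b b').symm
      · unfold prismDist
        split_ifs <;> norm_num
  | .inl (i, b), .inr k =>
    exact ⟨_, dist_prism_axis hc i b k, prismAxisDist_pos_le b k⟩
  | .inr k, .inl (i, b) =>
    exact ⟨_, (dist_comm _ _).trans (dist_prism_axis hc i b k), prismAxisDist_pos_le b k⟩
  | .inr k, .inr l =>
    have hkl : k ≠ l := by rintro rfl; exact hxy rfl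
    refine ⟨(axisHeight k - axisHeight l).natAbs, ?_, ?_, axisHeight_sub_le k l⟩
    · apply dist_liftPoint_eq
      simp [Nat.cast_natAbs, sq_abs]
    · exact Int.natAbs_pos.2 (sub_ne_zero.2 (axisHeight_injective.ne hkl))

theorem affineSpan_range_prismAxisPoint {n : ℕ} {t c : ℝ} (hn : 0 < n) (ht : t ≠ 0)
    (htc : t - n * c ≠ 0) : affineSpan ℝ (Set.range (prismAxisPoint n t c)) = ⊤ := by
  have hne : (affineSpan ℝ (Set.range (prismAxisPoint n t c)) :
      Set (EuclideanSpace ℝ (Fin (n + 1)))).Nonempty :=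
    (affineSpan_nonempty ℝ).2 ⟨_, Set.mem_range_self (Sum.inr 0)⟩
  rw [← AffineSubspace.direction_eq_top_iff_of_nonempty hne, ← Submodule.orthogonal_eq_bot_iff,
    Submodule.eq_bot_iff]
  intro v hv
  rw [Submodule.mem_orthogonal] at hv
  have key : ∀ x y, inner ℝ (prismAxisPoint n t c x - prismAxisPoint n t c y) v = 0 := fun x y =>
    hv _ (AffineSubspace.vsub_mem_direction (mem_affineSpan ℝ (Set.mem_range_self x))
      (mem_affineSpan ℝ (Set.mem_range_self y)))
  have height_zero : v 0 = 0 := by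
    have h := key (.inl (⟨0, hn⟩, 1)) (.inl (⟨0, hn⟩, 0))
    simpa [prismAxisPoint, liftPoint, prismHeight, PiLp.inner_apply, Fin.sum_univ_succ] using h
  have base : ∀ i : Fin n, t * v i.succ = c * ∑ j : Fin n, v j.succ := by
    intro i
    have h := key (.inl (i, 0)) (.inr 0)
    simp only [prismAxisPoint, liftPoint, PiLp.inner_apply, Fin.sum_univ_succ (n := n),
      height_zero, PiLp.sub_apply, Fin.cons_succ, RCLike.inner_apply, conj_trivial, zero_mul,
      mul_sub, Finset.sum_sub_distrib, ← Finset.sum_mul] at h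
    simp only [Pi.single_apply, mul_ite, mul_zero, Finset.sum_ite_eq', Finset.mem_univ,
      if_true] at h
    linear_combination h
  have sum_zero : ∑ j : Fin n, v j.succ = 0 := by
    have h : t * ∑ i : Fin n, v i.succ = n * (c * ∑ j : Fin n, v j.succ) := by
      rw [Finset.mul_sum, Finset.sum_congr rfl fun i _ => base i]
      simp
    have h' : (t - n * c) * ∑ j : Fin n, v j.succ = 0 := by linear_combination h
    exact (mul_eq_zero.1 h').resolve_left htc
  ext i
  refine Fin.cases height_zero (fun j => ?_) i
  have h := base j
  rw [sum_zero, mul_zero] at h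
  exact (mul_eq_zero.1 h).resolve_left ht

/-- For every integer `m ≥ 2`, there exists an integral point set of `2 * m + 16` points in
`ℝ^m` (pairwise integral distances, not contained in any affine hyperplane) whose
diameter is at most `6586`; that is, `d(m, 2 * m + 16) ≤ 6586`. -/
theorem d_bound_stmt_18 :
    ∀ m : ℕ, 2 ≤ m →
      ∃ S : Finset (EuclideanSpace ℝ (Fin m)),
        S.card = 2 * m + 16 ∧
        affineSpan ℝ (S : Set (EuclideanSpace ℝ (Fin m))) = ⊤ ∧
        (∀ p ∈ S, ∀ q ∈ S, ∃ z : ℤ, dist p q = (z : ℝ)) ∧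
        Metric.diam (S : Set (EuclideanSpace ℝ (Fin m))) ≤ 6586 := by
  intro m hm
  obtain ⟨n, rfl⟩ : ∃ n, m = n + 1 := ⟨m - 1, by omega⟩
  have hn : 0 < n := by omega
  obtain ⟨t, c, ht, hc, htc⟩ := exists_base_parameters hn
  have hinj : Function.Injective (prismAxisPoint n t c) := by
    intro x y hxy
    by_contra hne
    obtain ⟨z, hz, hpos, -⟩ := dist_prismAxisPoint ht hc hne
    rw [hxy, dist_self] at hz
    exact hpos.ne (by exact_mod_cast hz)
  have hdist : ∀ x y, ∃ z : ℕ,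
      dist (prismAxisPoint n t c x) (prismAxisPoint n t c y) = z ∧ z ≤ 6586 := by
    intro x y
    rcases eq_or_ne x y with rfl | hxy
    · exact ⟨0, by simp, by norm_num⟩
    · obtain ⟨z, hz, -, hle⟩ := dist_prismAxisPoint ht hc hxy
      exact ⟨z, hz, hle⟩
  refine ⟨Finset.univ.map ⟨prismAxisPoint n t c, hinj⟩, ?_, ?_, ?_, ?_⟩
  · simp
    ring
  · have ht0 : t ≠ 0 := by rintro rfl; norm_num at ht
    simpa using affineSpan_range_prismAxisPoint hn ht0 htc
  · simp only [Finset.mem_map, Finset.mem_univ, true_and, Function.Embedding.coeFn_mk]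
    rintro _ ⟨x, rfl⟩ _ ⟨y, rfl⟩
    obtain ⟨z, hz, -⟩ := hdist x y
    exact ⟨z, by simpa using hz⟩
  · refine Metric.diam_le_of_forall_dist_le (by norm_num) ?_
    simp only [Finset.mem_coe, Finset.mem_map, Finset.mem_univ, true_and,
      Function.Embedding.coeFn_mk]
    rintro _ ⟨x, rfl⟩ _ ⟨y, rfl⟩
    obtain ⟨z, hz, hle⟩ := hdist x y
    rw [hz]
    exact_mod_cast hle
end
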